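/- Let Ω ⊆ ℝ^d be a bounded open set whose closure Ω̄ is the union of finitely many polytopes F_1,…,F_N (each the convex hull of its finite vertex set), and let V be the finite set of all vertices of the F_ℓ. Let ρ_1,…,ρ_m : Ω̄ → ℝ be continuous functions that are affine on each F_ℓ, and let H : M(Ω̄) → ℝ^m, (Hμ)_i = ∫ ρ_i dμ. Let f_b : ℝ^m → ℝ ∪ {+∞} be proper, convex and lower semicontinuous; assume the primal problem min_{μ ∈ M(Ω̄)} f_b(Hμ) + ‖μ‖_TV attains its minimum, that the dual problem sup{ −f_b^*(q) : q ∈ ℝ^m, ‖Σ_i q_i ρ_i‖_∞ ≤ 1 } has a solution, and that the two optimal values coincide. Then the primal problem has at least one solution of the form μ̂ = Σ_{v ∈ V} d_v δ_v, i.e. an atomic solution supported on the vertices of the polyhedral pieces. -/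

import Mathlib

open MeasureTheory Filter Topology

/-- The total variation norm of a finite signed Borel measure. -/
noncomputable def tv {α : Type*} [MeasurableSpace α] (μ : SignedMeasure α) : ℝ :=
  (μ.totalVariation Set.univ).toReal

/-- Integration of a real function against a finite signed Borel measure. -/
noncomputable def sint {α : Type*} [MeasurableSpace α] (μ : SignedMeasure α) (f : α → ℝ) : ℝ :=
  ∫ x, f x ∂μ.toJordanDecomposition.posPart - ∫ x, f x ∂μ.toJordanDecomposition.negPart

/-- The Dirac measure at `x`, as a signed measure. -/
noncomputable def sdirac {α : Type*} [MeasurableSpace α] (x : α) : SignedMeasure α :=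
  (Measure.dirac x).toSignedMeasure

/-- The Fenchel conjugate `f*(q) = sup_x ⟨q,x⟩ − f(x)` of an extended-real-valued function. -/
noncomputable def fstar {m : ℕ} (f : (Fin m → ℝ) → EReal) (q : Fin m → ℝ) : EReal :=
  ⨆ x : Fin m → ℝ, (((∑ i, q i * x i : ℝ) : EReal) - f x)

/-- Integration against a difference of two finite measures. -/
theorem sint_toSignedMeasure_sub {α : Type*} [MeasurableSpace α] (P Q : Measure α)
    [IsFiniteMeasure P] [IsFiniteMeasure Q] {g : α → ℝ} (hP : Integrable g P)
    (hQ : Integrable g Q) :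
    sint (P.toSignedMeasure - Q.toSignedMeasure) g = ∫ x, g x ∂P - ∫ x, g x ∂Q := by
  have key : (P - Q) + Q = (Q - P) + P := by
    rw [← Measure.toSignedMeasure_eq_toSignedMeasure_iff, Measure.toSignedMeasure_add,
      Measure.toSignedMeasure_add]
    have h := Measure.sub_toSignedMeasure_eq_toSignedMeasure_sub (μ := P) (ν := Q)
    rw [sub_eq_sub_iff_add_eq_add] at h
    rw [← h]
    abel
  have h1 : Integrable g (P - Q) := hP.mono_measure Measure.sub_le
  have h2 : Integrable g (Q - P) := hQ.mono_measure Measure.sub_le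
  have h3 := congrArg (fun μ : Measure α => ∫ x, g x ∂μ) key
  simp only [integral_add_measure h1 hQ, integral_add_measure h2 hP] at h3
  unfold sint
  rw [Measure.toJordanDecomposition_toSignedMeasure_sub,
    Measure.jordanDecompositionOfToSignedMeasureSub_posPart,
    Measure.jordanDecompositionOfToSignedMeasureSub_negPart]
  linarith

/-- The total variation of a difference of two finite measures is at most their total mass. -/
theorem tv_toSignedMeasure_sub_le {α : Type*} [MeasurableSpace α] (P Q : Measure α)
    [IsFiniteMeasure P] [IsFiniteMeasure Q] :
    tv (P.toSignedMeasure - Q.toSignedMeasure) ≤ P.real Set.univ + Q.real Set.univ := by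
  unfold tv SignedMeasure.totalVariation
  rw [Measure.toJordanDecomposition_toSignedMeasure_sub,
    Measure.jordanDecompositionOfToSignedMeasureSub_posPart,
    Measure.jordanDecompositionOfToSignedMeasureSub_negPart, ← measureReal_def,
    measureReal_add_apply]
  have h1 : (P - Q).real Set.univ ≤ P.real Set.univ :=
    ENNReal.toReal_mono (measure_ne_top _ _) (Measure.sub_le _)
  have h2 : (Q - P).real Set.univ ≤ Q.real Set.univ :=
    ENNReal.toReal_mono (measure_ne_top _ _) (Measure.sub_le _)
  linarith

theorem tv_eq_posPart_add_negPart {α : Type*} [MeasurableSpace α] (μ : SignedMeasure α) :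
    tv μ = μ.toJordanDecomposition.posPart.real Set.univ
      + μ.toJordanDecomposition.negPart.real Set.univ := by
  unfold tv SignedMeasure.totalVariation
  rw [← measureReal_def, measureReal_add_apply]

theorem sum_smul_sdirac_eq {α : Type*} [MeasurableSpace α] {p : ℕ} (v : Fin p → α)
    (a : Fin p → NNReal) :
    (∑ k, a k • Measure.dirac (v k)).toSignedMeasure = ∑ k, (a k : ℝ) • sdirac (v k) := by
  ext s hs
  rw [Measure.toSignedMeasure_apply_measurable hs, measureReal_def, Measure.finsetSum_apply,
    ENNReal.toReal_sum (fun k _ => measure_ne_top _ _)]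
  simp [sdirac, Measure.toSignedMeasure_apply_measurable hs,
    measureReal_def]

theorem integral_sum_smul_dirac {α : Type*} [MeasurableSpace α] {p : ℕ} (v : Fin p → α)
    (a : Fin p → NNReal) {g : α → ℝ} (hg : StronglyMeasurable g) :
    Integrable g (∑ k, a k • Measure.dirac (v k)) ∧
      ∫ x, g x ∂(∑ k, a k • Measure.dirac (v k)) = ∑ k, (a k : ℝ) * g (v k) := by
  have h : ∀ k ∈ Finset.univ, Integrable g (a k • Measure.dirac (v k)) := fun k _ =>
    (integrable_dirac' hg (by simp)).smul_measure_nnreal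
  refine ⟨integrable_finsetSum_measure.2 h, ?_⟩
  rw [integral_finsetSum_measure h]
  refine Finset.sum_congr rfl fun k _ => ?_
  rw [integral_smul_nnreal_measure, integral_dirac' _ _ hg]
  rfl

theorem real_univ_sum_smul_dirac {α : Type*} [MeasurableSpace α] {p : ℕ} (v : Fin p → α)
    (a : Fin p → NNReal) :
    (∑ k, a k • Measure.dirac (v k)).real Set.univ = ∑ k, (a k : ℝ) := by
  rw [measureReal_def, Measure.finsetSum_apply, ENNReal.toReal_sum (fun k _ => measure_ne_top _ _)]
  simp

theorem exists_weights_of_mem_convexHull_range {E ι : Type*} [AddCommGroup E] [Module ℝ E]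
    [Fintype ι] {g : ι → E} {y : E} (hy : y ∈ convexHull ℝ (Set.range g)) :
    ∃ w : ι → NNReal, ∑ k, (w k : ℝ) = 1 ∧ ∑ k, (w k : ℝ) • g k = y := by
  classical
  have hsub : convexHull ℝ (Set.range g) ⊆
      Fintype.linearCombination ℝ g '' stdSimplex ℝ ι := by
    refine convexHull_min ?_ ((convex_stdSimplex ℝ ι).linear_image _)
    rintro _ ⟨k, rfl⟩
    exact ⟨Pi.single k 1, single_mem_stdSimplex ℝ k, by simp⟩
  obtain ⟨w, ⟨hw0, hw1⟩, rfl⟩ := hsub hy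
  exact ⟨fun k => ⟨w k, hw0 k⟩, hw1, (Fintype.linearCombination_apply ℝ g w).symm⟩

/-- A finite measure has the same mass and the same moments `∫ r` as a measure supported on
finitely many points `v k`, as soon as `r` takes its values in the convex hull of the `r (v k)`. -/
theorem exists_weights_integral {α : Type*} [MeasurableSpace α] {m p : ℕ} (P : Measure α)
    [IsFiniteMeasure P] {r : α → Fin m → ℝ} (v : Fin p → α)
    (hr : ∀ x, r x ∈ convexHull ℝ (Set.range fun k => r (v k))) (hint : Integrable r P) :
    ∃ a : Fin p → NNReal, ∑ k, (a k : ℝ) = P.real Set.univ ∧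
      ∀ i, ∑ k, (a k : ℝ) * r (v k) i = ∫ x, r x i ∂P := by
  rcases eq_or_ne P 0 with rfl | hP
  · exact ⟨0, by simp, by simp⟩
  have : NeZero P := ⟨hP⟩
  have hmem : (⨍ x, r x ∂P) ∈ convexHull ℝ (Set.range fun k => r (v k)) :=
    (convex_convexHull ℝ _).average_mem ((Set.finite_range _).isClosed_convexHull ℝ)
      (Eventually.of_forall hr) hint
  obtain ⟨w, hw1, hw⟩ := exists_weights_of_mem_convexHull_range hmem
  refine ⟨fun k => (P.real Set.univ).toNNReal * w k, ?_, fun i => ?_⟩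
  · simp [← Finset.mul_sum, hw1, measureReal_nonneg]
  · have h := measure_smul_average P r
    rw [← hw] at h
    have h' := congrFun h i
    rw [eval_integral (fun i => hint.eval i)] at h'
    rw [← h']
    simp [Finset.mul_sum, mul_assoc, measureReal_nonneg]

theorem affine_mem_convexHull_image_extremePoints {d m : ℕ} (S : Finset (Fin d → ℝ))
    (r : (Fin d → ℝ) → Fin m → ℝ)
    (hr : ∀ i, ∃ (α : Fin d → ℝ) (β : ℝ), ∀ x ∈ convexHull ℝ (S : Set (Fin d → ℝ)),
      r x i = (∑ j, α j * x j) + β)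
    {x : Fin d → ℝ} (hx : x ∈ convexHull ℝ (S : Set (Fin d → ℝ))) :
    r x ∈ convexHull ℝ (r '' (convexHull ℝ (S : Set (Fin d → ℝ))).extremePoints ℝ) := by
  set C := convexHull ℝ (S : Set (Fin d → ℝ)) with hC
  have hfin : (C.extremePoints ℝ).Finite :=
    S.finite_toSet.subset extremePoints_convexHull_subset
  have hKM : convexHull ℝ (C.extremePoints ℝ) = C := by
    rw [← (hfin.isClosed_convexHull ℝ).closure_eq]
    exact closure_convexHull_extremePoints (S.finite_toSet.isCompact_convexHull ℝ)
      (convex_convexHull ℝ _)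
  have hx' := hx
  rw [← hKM, mem_convexHull_iff_exists_fintype] at hx'
  obtain ⟨ι, _, w, z, hw0, hw1, hz, hwz⟩ := hx'
  refine mem_convexHull_of_exists_fintype w (fun k => r (z k)) hw0 hw1
    (fun k => Set.mem_image_of_mem r (hz k)) ?_
  ext i
  obtain ⟨α, β, h⟩ := hr i
  simp only [Finset.sum_apply, Pi.smul_apply, smul_eq_mul]
  rw [h x hx, ← hwz]
  simp only [fun k => h (z k) (hz k).1, mul_add, Finset.sum_add_distrib, ← Finset.sum_mul, hw1,
    one_mul, Finset.sum_apply, Pi.smul_apply, smul_eq_mul, Finset.mul_sum]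
  rw [Finset.sum_comm]
  congr 1
  exact Finset.sum_congr rfl fun j _ => Finset.sum_congr rfl fun k _ => by ring

/-- Piecewise linear measurements: suppose the closure of a bounded open `Ω ⊆ ℝ^d` is the
union of finitely many polytopes `F_ℓ = conv(Vert ℓ)`, and the measurement functions
`ρ_1, …, ρ_m` are continuous on `closure Ω` and affine on each `F_ℓ`. If `f_b` is proper,
convex and lower semicontinuous, the primal problem `min_μ f_b(Hμ) + ‖μ‖_TV` over
`M(closure Ω)` is attained, the dual problem `sup {−f_b^*(q) : ‖Σ_i q_i ρ_i‖_∞ ≤ 1}` has a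
solution, and the optimal values coincide, then the primal problem has at least one solution
which is an atomic measure supported on the vertices (extreme points) of the polytopes. -/
theorem stmt18 {d m N : ℕ} (Ω : Set (Fin d → ℝ)) (hΩ : IsOpen Ω)
    (hbdd : Bornology.IsBounded Ω)
    (Vert : Fin N → Finset (Fin d → ℝ))
    (hcover : closure Ω = ⋃ ℓ, convexHull ℝ (Vert ℓ : Set (Fin d → ℝ)))
    (ρ : Fin m → (Fin d → ℝ) → ℝ)
    (hρcont : ∀ i, ContinuousOn (ρ i) (closure Ω))
    (hρaff : ∀ (i : Fin m) (ℓ : Fin N), ∃ (α : Fin d → ℝ) (β : ℝ),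
      ∀ x ∈ convexHull ℝ (Vert ℓ : Set (Fin d → ℝ)), ρ i x = (∑ j, α j * x j) + β)
    (H : SignedMeasure (closure Ω) → Fin m → ℝ)
    (hH : ∀ μ i, H μ i = sint μ (fun x => ρ i (x : Fin d → ℝ)))
    (f : (Fin m → ℝ) → EReal)
    (hbot : ∀ x, f x ≠ ⊥) (hproper : ∃ x, f x ≠ ⊤)
    (hconv : ∀ (x y : Fin m → ℝ) (t : ℝ), 0 ≤ t → t ≤ 1 →
      f (t • x + (1 - t) • y) ≤ ((t : ℝ) : EReal) * f x + (((1 - t : ℝ)) : EReal) * f y)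
    (hlsc : LowerSemicontinuous f)
    (μ0 : SignedMeasure (closure Ω))
    (hmin : ∀ μ : SignedMeasure (closure Ω),
      f (H μ0) + (tv μ0 : EReal) ≤ f (H μ) + (tv μ : EReal))
    (qhat : Fin m → ℝ)
    (hqfeas : ∀ x : closure Ω, |∑ i, qhat i * ρ i (x : Fin d → ℝ)| ≤ 1)
    (hqopt : ∀ q : Fin m → ℝ, (∀ x : closure Ω, |∑ i, q i * ρ i (x : Fin d → ℝ)| ≤ 1) →
      - fstar f q ≤ - fstar f qhat)
    (hdual : f (H μ0) + (tv μ0 : EReal) = - fstar f qhat) :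
    ∃ (p : ℕ) (v : Fin p → closure Ω) (dcoef : Fin p → ℝ),
      (∀ k, ∃ ℓ : Fin N,
        (v k : Fin d → ℝ) ∈ Set.extremePoints ℝ (convexHull ℝ (Vert ℓ : Set (Fin d → ℝ)))) ∧
      (∀ μ : SignedMeasure (closure Ω),
        f (H (∑ k, dcoef k • sdirac (v k))) + (tv (∑ k, dcoef k • sdirac (v k)) : EReal)
          ≤ f (H μ) + (tv μ : EReal)) := by
  let V : Set (closure Ω) := {x | ∃ ℓ : Fin N,
    (x : Fin d → ℝ) ∈ Set.extremePoints ℝ (convexHull ℝ (Vert ℓ : Set (Fin d → ℝ)))}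
  have hVfin : V.Finite := by
    have hfin : (⋃ ℓ, (Vert ℓ : Set (Fin d → ℝ))).Finite :=
      Set.finite_iUnion fun ℓ => (Vert ℓ).finite_toSet
    refine (hfin.preimage Subtype.val_injective.injOn).subset ?_
    rintro x ⟨ℓ, hℓ⟩
    exact Set.mem_iUnion.2 ⟨ℓ, extremePoints_convexHull_subset hℓ⟩
  obtain ⟨p, v, -, hv⟩ := hVfin.fin_param
  have : CompactSpace (closure Ω) := isCompact_iff_compactSpace.1 hbdd.isCompact_closure
  let r : closure Ω → Fin m → ℝ := fun x i => ρ i x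
  have hri : ∀ i, Continuous fun x => r x i := fun i =>
    continuousOn_iff_continuous_domRestrict.1 (hρcont i)
  have hr : Continuous r := continuous_pi hri
  have hint : ∀ (P : Measure (closure Ω)) [IsFiniteMeasure P], Integrable r P := fun P _ =>
    hr.integrable_of_hasCompactSupport (HasCompactSupport.of_compactSpace r)
  have hmem : ∀ x, r x ∈ convexHull ℝ (Set.range fun k => r (v k)) := by
    intro x
    obtain ⟨ℓ, hℓ⟩ := Set.mem_iUnion.1 (hcover.subset x.2)
    refine convexHull_mono ?_ (affine_mem_convexHull_image_extremePoints (Vert ℓ)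
      (fun y i => ρ i y) (fun i => hρaff i ℓ) hℓ)
    rintro _ ⟨y, hy, rfl⟩
    have hyK : y ∈ closure Ω := hcover.superset (Set.mem_iUnion.2 ⟨ℓ, hy.1⟩)
    obtain ⟨k, hk⟩ : (⟨y, hyK⟩ : closure Ω) ∈ Set.range v := hv ▸ ⟨ℓ, hy⟩
    exact ⟨k, by simp only [hk, r]⟩
  obtain ⟨a, ha, ha'⟩ :=
    exists_weights_integral μ0.toJordanDecomposition.posPart v hmem (hint _)
  obtain ⟨b, hb, hb'⟩ :=
    exists_weights_integral μ0.toJordanDecomposition.negPart v hmem (hint _)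
  have hν : ∑ k, ((a k : ℝ) - b k) • sdirac (v k) =
      (∑ k, a k • Measure.dirac (v k)).toSignedMeasure
        - (∑ k, b k • Measure.dirac (v k)).toSignedMeasure := by
    rw [sum_smul_sdirac_eq, sum_smul_sdirac_eq, ← Finset.sum_sub_distrib]
    exact Finset.sum_congr rfl fun k _ => by ext s hs; simp [sub_mul]
  refine ⟨p, v, fun k => (a k : ℝ) - b k, fun k => hv.subset ⟨k, rfl⟩, fun μ => ?_⟩
  refine le_trans ?_ (hmin μ)
  have hH' : H (∑ k, ((a k : ℝ) - b k) • sdirac (v k)) = H μ0 := by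
    ext i
    have hA := integral_sum_smul_dirac v a (hri i).stronglyMeasurable
    have hB := integral_sum_smul_dirac v b (hri i).stronglyMeasurable
    rw [hH, hH, hν, sint_toSignedMeasure_sub _ _ hA.1 hB.1, hA.2, hB.2, ha', hb']
    rfl
  have htv : tv (∑ k, ((a k : ℝ) - b k) • sdirac (v k)) ≤ tv μ0 := by
    rw [hν, tv_eq_posPart_add_negPart μ0, ← ha, ← hb, ← real_univ_sum_smul_dirac v a,
      ← real_univ_sum_smul_dirac v b]
    exact tv_toSignedMeasure_sub_le _ _
  rw [hH']
  exact add_le_add_right (EReal.coe_le_coe_iff.2 htv) _
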